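/- arXiv:1512.01985 — 2 statements merged into one kernel-verified Lean document; each statement's English description precedes it below -/
import Mathlib

section
/- Let X, δX ∈ ℝ^{m×n}, σ ∈ ℝ, and let u : ℝ → ℝ^m and v : ℝ → ℝ^n be differentiable at 0 with ‖u(ε)‖ = 1 and ‖v(ε)‖ = 1 for all ε in a neighborhood of 0. Assume (u(0), v(0)) is a singular pair of X with singular value σ, i.e., X·v(0) = σ·u(0) and Xᵀ·u(0) = σ·v(0). Then the derivative at ε = 0 of the perturbed singular value expression ε ↦ u(ε)ᵀ·(X + ε·δX)·v(ε) equals u(0)ᵀ·δX·v(0). In other words, the first-order (linear) change of the singular value under the perturbation δX is δσ = uᵀ·δX·v. -/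
open Matrix

lemma coord_hasDerivAt {k : ℕ} (u : ℝ → EuclideanSpace ℝ (Fin k))
    (hud : DifferentiableAt ℝ u 0) (i : Fin k) :
    HasDerivAt (fun ε => u ε i) (deriv u 0 i) 0 :=
  (EuclideanSpace.proj i : EuclideanSpace ℝ (Fin k) →L[ℝ] ℝ).hasFDerivAt.comp_hasDerivAt
    (0 : ℝ) hud.hasDerivAt

lemma unit_orth {k : ℕ} (u : ℝ → EuclideanSpace ℝ (Fin k))
    (hud : DifferentiableAt ℝ u 0) (hu : ∀ᶠ ε in nhds 0, ‖u ε‖ = 1) :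
    ∑ i, deriv u 0 i * u 0 i = 0 := by
  have h1 : HasDerivAt (fun ε => ∑ i, u ε i * u ε i)
      (∑ i, (deriv u 0 i * u 0 i + u 0 i * deriv u 0 i)) 0 :=
    HasDerivAt.fun_sum fun i _ => (coord_hasDerivAt u hud i).mul (coord_hasDerivAt u hud i)
  have h2 : HasDerivAt (fun ε => ∑ i, u ε i * u ε i) 0 0 := by
    refine (hasDerivAt_const (0 : ℝ) (1 : ℝ)).congr_of_eventuallyEq ?_
    filter_upwards [hu] with ε hε
    have := EuclideanSpace.real_norm_sq_eq (u ε)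
    rw [hε] at this
    simp only [← pow_two]
    linarith
  have h3 := h1.unique h2
  rw [Finset.sum_add_distrib] at h3
  have h4 : ∑ i, u 0 i * deriv u 0 i = ∑ i, deriv u 0 i * u 0 i :=
    Finset.sum_congr rfl fun i _ => mul_comm _ _
  linarith

/-- First-order perturbation of a singular value. If `(u(0), v(0))` is a
singular pair of `X` with singular value `σ`, `u, v` are unit-norm curves differentiable
at `0`, then `d/dε [u(ε)ᵀ (X + ε δX) v(ε)]` at `ε = 0` equals `u(0)ᵀ δX v(0)`, i.e.
`δσ = uᵀ δX v`. -/
theorem singular_value_first_order_perturbation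
    (m n : ℕ) (X δX : Matrix (Fin m) (Fin n) ℝ) (σ : ℝ)
    (u : ℝ → EuclideanSpace ℝ (Fin m)) (v : ℝ → EuclideanSpace ℝ (Fin n))
    (hud : DifferentiableAt ℝ u 0) (hvd : DifferentiableAt ℝ v 0)
    (hunorm : ∀ᶠ ε in nhds 0, ‖u ε‖ = 1)
    (hvnorm : ∀ᶠ ε in nhds 0, ‖v ε‖ = 1)
    (hpair1 : X.mulVec (fun j => v 0 j) = fun i => σ * u 0 i)
    (hpair2 : Xᵀ.mulVec (fun i => u 0 i) = fun j => σ * v 0 j) :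
    deriv (fun ε : ℝ => ∑ i, ∑ j, u ε i * ((X + ε • δX) i j) * v ε j) 0 =
      ∑ i, ∑ j, u 0 i * δX i j * v 0 j := by
  have hX : ∀ i j, HasDerivAt (fun ε : ℝ => (X + ε • δX) i j) (δX i j) 0 := by
    intro i j
    simpa using ((hasDerivAt_id (0 : ℝ)).mul_const (δX i j)).const_add (X i j)
  have h := HasDerivAt.fun_sum (u := Finset.univ) fun i _ =>
    HasDerivAt.fun_sum (u := Finset.univ) fun j _ =>
      ((coord_hasDerivAt u hud i).mul (hX i j)).mul (coord_hasDerivAt v hvd j)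
  refine h.deriv.trans ?_
  have e1 : ∑ i, ∑ j, deriv u 0 i * X i j * v 0 j = 0 := by
    have : ∀ i, ∑ j, deriv u 0 i * X i j * v 0 j = σ * (deriv u 0 i * u 0 i) := by
      intro i
      have := congrFun hpair1 i
      simp only [Matrix.mulVec, dotProduct] at this
      simp only [mul_assoc, ← Finset.mul_sum]
      rw [this]; ring
    simp only [this, ← Finset.mul_sum, unit_orth u hud hunorm, mul_zero]
  have e2 : ∑ i, ∑ j, u 0 i * X i j * deriv v 0 j = 0 := by
    rw [Finset.sum_comm]
    have : ∀ j, ∑ i, u 0 i * X i j * deriv v 0 j = σ * (deriv v 0 j * v 0 j) := by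
      intro j
      have := congrFun hpair2 j
      simp only [Matrix.mulVec, dotProduct, Matrix.transpose_apply] at this
      rw [← Finset.sum_mul]
      simp only [mul_comm (u 0 _)]
      rw [this]; ring
    simp only [this, ← Finset.mul_sum, unit_orth v hvd hvnorm, mul_zero]
  simp [add_mul, Finset.sum_add_distrib, e1, e2]
end

section
/- Let L > 0, N ∈ ℕ with N ≥ 1, grid size h = L/N and grid points x_i = i·h for i ∈ {0, …, N−1}. Let g : ℝ → ℝ be L-periodic, let ρ0, c ∈ ℝ, and let t_1, …, t_M be times such that c·t_j = k_j·h with k_j ∈ ℤ for every j. Define the snapshot matrix X ∈ ℝ^{N×M} of the pressure-pulse density by X_{ij} = ρ0·(g(x_i − c t_j) + g(x_i + c t_j)). Then X = Y + Z, where Y_{ij} = ρ0·g(x_i − c t_j) and Z_{ij} = ρ0·g(x_i + c t_j), and the back-shifted matrices defined entrywise by (T^{−c}Y)_{ij} = Y_{((i + k_j) mod N), j} and (T^{c}Z)_{ij} = Z_{((i − k_j) mod N), j} each have all columns equal and hence rank at most 1. In particular, X admits an exact shifted decomposition with exactly one mode in the velocity-c frame and one mode in the velocity-(−c) frame. -/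
open Matrix

/-- Values of an `L`-periodic function at grid points depend only on the index mod `N`. -/
theorem grid_periodic (L : ℝ) (N : ℕ) [NeZero N] (h : ℝ) (hh : h = L / N)
    (g : ℝ → ℝ) (hper : ∀ y, g (y + L) = g y) (a b : ℤ)
    (hab : (a : ZMod N) = (b : ZMod N)) : g (a * h) = g (b * h) := by
  obtain ⟨m, hm⟩ := (ZMod.intCast_eq_intCast_iff_dvd_sub a b N).1 hab
  have hN : (N : ℝ) ≠ 0 := Nat.cast_ne_zero.2 (NeZero.ne N)
  have hNh : (N : ℝ) * h = L := by rw [hh]; field_simp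
  have hb : (b : ℝ) = a + N * m := by
    have : b = a + N * m := by linarith
    exact_mod_cast this
  have hP : Function.Periodic g L := hper
  have e : (b : ℝ) * h = a * h + m * L := by rw [hb, ← hNh]; ring
  rw [e]
  exact (hP.int_mul m (a * h)).symm

/-- A matrix with equal columns has rank at most one. -/
theorem rank_le_one_of_columns {N : ℕ} [NeZero N] {M : ℕ} (A : Matrix (ZMod N) (Fin M) ℝ)
    (f : ZMod N → ℝ) (hA : ∀ i j, A i j = f i) : A.rank ≤ 1 := by
  have : A = Matrix.vecMulVec f (fun _ => 1) := by
    ext i j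
    simp [Matrix.vecMulVec_apply, hA]
  rw [this]
  exact Matrix.rank_vecMulVec_le _ _

/-- On a periodic grid `x_i = i·L/N` (rows indexed cyclically by `ZMod N`),
the pressure-pulse snapshot matrix `X_{ij} = ρ0(g(x_i − c t_j) + g(x_i + c t_j))` with
grid-aligned shifts `c t_j = k_j h` splits as `X = Y + Z`, and the back-shifted matrices
`(T^{−c}Y)_{ij} = Y_{(i + k_j) mod N, j}` and `(T^{c}Z)_{ij} = Z_{(i − k_j) mod N, j}`
have all columns equal, hence rank at most 1: `X` admits an exact shifted decomposition
with exactly one mode per velocity frame. -/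
theorem pressure_pulse_snapshot_has_one_mode_per_frame
    (L : ℝ) (hL : 0 < L) (N : ℕ) [NeZero N] (hN : 1 ≤ N) (M : ℕ)
    (h : ℝ) (hh : h = L / N)
    (x : ZMod N → ℝ) (hx : ∀ i : ZMod N, x i = i.val * h)
    (g : ℝ → ℝ) (hper : ∀ y, g (y + L) = g y)
    (ρ0 c : ℝ) (t : Fin M → ℝ) (k : Fin M → ℤ)
    (hk : ∀ j, c * t j = k j * h)
    (X Y Z TY TZ : Matrix (ZMod N) (Fin M) ℝ)
    (hX : ∀ i j, X i j = ρ0 * (g (x i - c * t j) + g (x i + c * t j)))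
    (hY : ∀ i j, Y i j = ρ0 * g (x i - c * t j))
    (hZ : ∀ i j, Z i j = ρ0 * g (x i + c * t j))
    (hTY : ∀ i j, TY i j = Y (i + (k j : ZMod N)) j)
    (hTZ : ∀ i j, TZ i j = Z (i - (k j : ZMod N)) j) :
    X = Y + Z ∧
      (∀ (i : ZMod N) (j j' : Fin M), TY i j = TY i j') ∧
      (∀ (i : ZMod N) (j j' : Fin M), TZ i j = TZ i j') ∧
      TY.rank ≤ 1 ∧ TZ.rank ≤ 1 := by
  have key := grid_periodic L N h hh g hper
  have hY1 : ∀ i j, TY i j = ρ0 * g (x i) := by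
    intro i j
    rw [hTY, hY, hk, hx, hx]
    have := key (((i + (k j : ZMod N)).val : ℤ) - k j) (i.val : ℤ) (by simp)
    push_cast at this
    rw [← this]
    ring_nf
  have hZ1 : ∀ i j, TZ i j = ρ0 * g (x i) := by
    intro i j
    rw [hTZ, hZ, hk, hx, hx]
    have := key (((i - (k j : ZMod N)).val : ℤ) + k j) (i.val : ℤ) (by simp)
    push_cast at this
    rw [← this]
    ring_nf
  refine ⟨?_, ?_, ?_, rank_le_one_of_columns _ _ hY1, rank_le_one_of_columns _ _ hZ1⟩
  · ext i j
    rw [Matrix.add_apply, hX, hY, hZ]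
    ring
  · intro i j j'
    rw [hY1, hY1]
  · intro i j j'
    rw [hZ1, hZ1]
end
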